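/- Let k ≥ 1, P ∈ ℂ[X] of degree ≤ 2k, and x an irrational real number with continued fraction x = [n_0; n_1, n_2, …]. Set P₁ = P|(1+ε) and P₂ = P|(1+U−SU²)ε. Then P^Γ(x) − P^Γ(−x) = (−P₁|T^{n_0+1}σ)(x) + (P₂|T^{−n_0})(x) if n_1 ≥ 2, and P^Γ(x) − P^Γ(−x) = (P₁|T^{−n_0})(x) − (P₂|T^{n_0+1}σ)(x) if n_1 = 1. -/

import Mathlib

open Polynomial Matrix

noncomputable section

abbrev Mat2 := Matrix (Fin 2) (Fin 2) ℤ

/-- The matrix `Tⁿ = [[1,n],[0,1]]`. -/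
def Tpow (n : ℤ) : Mat2 := !![1, n; 0, 1]

/-- The matrix `ε = [[0,1],[1,0]]`. -/
def Meps : Mat2 := !![0, 1; 1, 0]

/-- The matrix `S = [[0,-1],[1,0]]`. -/
def MS : Mat2 := !![0, -1; 1, 0]

/-- The matrix `T = [[1,1],[0,1]]`. -/
def MT : Mat2 := !![1, 1; 0, 1]

/-- The matrix `σ = [[-1,0],[0,1]]`. -/
def Msig : Mat2 := !![-1, 0; 0, 1]

/-- The matrix `U = TS = [[1,-1],[1,0]]`. -/
def MU : Mat2 := MT * MS

/-- Möbius action of an integer matrix on a real number. -/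
def moeb (M : Mat2) (x : ℝ) : ℝ :=
  ((M 0 0 : ℝ) * x + (M 0 1 : ℝ)) / ((M 1 0 : ℝ) * x + (M 1 1 : ℝ))

/-- The sequence `x_i` of the (positive) continued fraction algorithm:
`x_0 = x`, `x_{i+1} = 1/(x_i - ⌊x_i⌋)`. -/
def cfX (x : ℝ) : ℕ → ℝ
  | 0 => x
  | i + 1 => 1 / (cfX x i - (⌊cfX x i⌋ : ℝ))

/-- The partial quotients `n_i = ⌊x_i⌋` of the continued fraction of `x`. -/
def cfN (x : ℝ) (i : ℕ) : ℤ := ⌊cfX x i⌋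

/-- The matrices `γ_0 = Id`, `γ_{i+1} = ε T^{-n_i} γ_i`. -/
def gam (x : ℝ) : ℕ → Mat2
  | 0 => 1
  | i + 1 => (Meps * Tpow (-(cfN x i))) * gam x i

/-- `Γ(x) = {γ_1, γ_2, γ_3, …}`. -/
def GammaSet (x : ℝ) : Set Mat2 := {M | ∃ i, 1 ≤ i ∧ M = gam x i}

/-- The matrices `γ'_0 = Id`, `γ'_{i+1} = Tγ'_i` if `γ'_i(x) ≤ 0`,
`T^{-1}εγ'_i` if `0 < γ'_i(x) ≤ 1`, and `T^{-1}γ'_i` if `γ'_i(x) > 1`. -/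
def gam' (x : ℝ) : ℕ → Mat2
  | 0 => 1
  | i + 1 =>
    if moeb (gam' x i) x ≤ 0 then MT * gam' x i
    else if moeb (gam' x i) x ≤ 1 then (Tpow (-1) * Meps) * gam' x i
    else Tpow (-1) * gam' x i

/-- `Γ(x)' = {γ'_1, γ'_2, γ'_3, …}`. -/
def GammaSet' (x : ℝ) : Set Mat2 := {M | ∃ i, 1 ≤ i ∧ M = gam' x i}

/-- The sequence `x_i` of the negative continued fraction algorithm:
`x_0 = x`, `x_{i+1} = 1/(⌈x_i⌉ - x_i)`. -/
def ncfX (x : ℝ) : ℕ → ℝ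
  | 0 => x
  | i + 1 => 1 / ((⌈ncfX x i⌉ : ℝ) - ncfX x i)

/-- The partial quotients `m_i = ⌈x_i⌉` of the negative continued fraction of `x`. -/
def ncfM (x : ℝ) (i : ℕ) : ℤ := ⌈ncfX x i⌉

/-- The matrices `γ̃_0 = Id`, `γ̃_{i+1} = S T^{-m_i} γ̃_i`. -/
def gamt (x : ℝ) : ℕ → Mat2
  | 0 => 1
  | i + 1 => (MS * Tpow (-(ncfM x i))) * gamt x i

/-- `Γ₁(x) = {γ̃_1, γ̃_2, γ̃_3, …}`. -/
def Gamma1Set (x : ℝ) : Set Mat2 := {M | ∃ i, 1 ≤ i ∧ M = gamt x i}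

/-- A binary quadratic polynomial `aX² + bX + c`, encoded as the triple `(a,b,c)`. -/
abbrev QF := ℤ × ℤ × ℤ

/-- The value of `aX² + bX + c` at a real number `x`. -/
def Qval (q : QF) (x : ℝ) : ℝ := (q.1 : ℝ) * x ^ 2 + (q.2.1 : ℝ) * x + (q.2.2 : ℝ)

/-- The value of `aX² + bX + c` at an integer `m`. -/
def QvalZ (q : QF) (m : ℤ) : ℤ := q.1 * m ^ 2 + q.2.1 * m + q.2.2

/-- The discriminant `b² - 4ac`. -/
def Qdisc (q : QF) : ℤ := q.2.1 ^ 2 - 4 * q.1 * q.2.2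

/-- The homogenized value `a r² + b r t + c t²`; for `t ≠ 0` its sign is that of `Q(r/t)`,
and for `t = 0` that of the leading coefficient, i.e. of `Q(∞)`. -/
def Qhom (q : QF) (r t : ℤ) : ℤ := q.1 * r ^ 2 + q.2.1 * r * t + q.2.2 * t ^ 2

/-- The weight 2 action `(Q|γ)(X) = (tX+u)² Q((rX+s)/(tX+u))` on quadratic polynomials,
for `γ = [[r,s],[t,u]]`. -/
def qslash (M : Mat2) (q : QF) : QF :=
  (Qhom q (M 0 0) (M 1 0),
   2 * q.1 * M 0 0 * M 0 1 + q.2.1 * (M 0 0 * M 1 1 + M 0 1 * M 1 0) + 2 * q.2.2 * M 1 0 * M 1 1,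
   Qhom q (M 0 1) (M 1 1))

/-- The set `𝒬` of integral quadratic polynomials with positive non-square discriminant. -/
def Qset : Set QF := {q | 0 < Qdisc q ∧ ¬ IsSquare (Qdisc q)}

/-- `A` is a `Γ`-equivalence class in `𝒬`, where `Γ = PGL₂(ℤ)`. -/
def IsClassQ (A : Set QF) : Prop :=
  ∃ q₀ ∈ Qset, A = {q ∈ Qset | ∃ M : Mat2, IsUnit M.det ∧ q = qslash M q₀}

/-- `B` is a `Γ₁`-equivalence class in `𝒬`, where `Γ₁ = PSL₂(ℤ)`. -/
def IsClassQ1 (B : Set QF) : Prop :=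
  ∃ q₀ ∈ Qset, B = {q ∈ Qset | ∃ M : Mat2, M.det = 1 ∧ q = qslash M q₀}

/-- `A^Sim = {Q ∈ A : Q(0) < 0 < Q(∞)}`. -/
def QSim (A : Set QF) : Set QF := {q ∈ A | q.2.2 < 0 ∧ 0 < q.1}

/-- `A^Red = {Q ∈ A : Q(∞) > 0, Q(-1) < 0 < Q(0)}`. -/
def QRed (A : Set QF) : Set QF := {q ∈ A | 0 < q.1 ∧ q.1 - q.2.1 + q.2.2 < 0 ∧ 0 < q.2.2}

/-- `A⟨x⟩ = {Q ∈ A : Q(∞) < 0 < Q(x)}`. -/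
def QxSet (A : Set QF) (x : ℝ) : Set QF := {q ∈ A | q.1 < 0 ∧ 0 < Qval q x}

/-- `𝒬_D⟨x⟩`, the set of quadratics of discriminant `D` with `Q(∞) < 0 < Q(x)`. -/
def QDx (D : ℕ) (x : ℝ) : Set QF :=
  {q | Qdisc q = (D : ℤ) ∧ q.1 < 0 ∧ 0 < Qval q x}

/-- The simple forms of discriminant `D`: `a > 0 > c`. -/
def SimpleD (D : ℕ) : Set QF := {q | Qdisc q = (D : ℤ) ∧ 0 < q.1 ∧ q.2.2 < 0}

/-- The reduced forms of discriminant `D`: `a > 0`, `c > 0`, `b > a + c`. -/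
def ReducedD (D : ℕ) : Set QF :=
  {q | Qdisc q = (D : ℤ) ∧ 0 < q.1 ∧ 0 < q.2.2 ∧ q.1 + q.2.2 < q.2.1}

/-- Homogenized evaluation of a polynomial of degree ≤ d: `∑ P_j r^j t^{d-j}`;
for `t ≠ 0` its sign is that of `P(r/t)` (`d` even), and for `t = 0` that of `P(∞)`. -/
def homEval (d : ℕ) (P : Polynomial ℤ) (r t : ℤ) : ℤ :=
  ∑ j ∈ Finset.range (d + 1), P.coeff j * r ^ j * t ^ (d - j)

/-- The weight `d` action `(P|γ)(X) = (tX+u)^d P((rX+s)/(tX+u))` on integral polynomials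
of degree at most `d`, for `γ = [[r,s],[t,u]]`. -/
def pslash (d : ℕ) (M : Mat2) (P : Polynomial ℤ) : Polynomial ℤ :=
  ∑ j ∈ Finset.range (d + 1),
    C (P.coeff j) * (C (M 0 0) * X + C (M 0 1)) ^ j * (C (M 1 0) * X + C (M 1 1)) ^ (d - j)

/-- `P` has exactly two real roots `w ≠ w'`, both irrational. -/
def HasTwoIrratRoots (P : Polynomial ℤ) (w w' : ℝ) : Prop :=
  w ≠ w' ∧ Irrational w ∧ Irrational w' ∧ ∀ y : ℝ, Polynomial.aeval y P = 0 ↔ y = w ∨ y = w'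

/-- `F_d`: integral polynomials of degree ≤ d with exactly two real roots, both irrational. -/
def Fd (d : ℕ) : Set (Polynomial ℤ) :=
  {P | P.natDegree ≤ d ∧ ∃ w w' : ℝ, HasTwoIrratRoots P w w'}

/-- `A` is a `Γ`-equivalence class in `F_d`, where `Γ = PGL₂(ℤ)`. -/
def IsClassF (d : ℕ) (A : Set (Polynomial ℤ)) : Prop :=
  ∃ P₀ ∈ Fd d, A = {P ∈ Fd d | ∃ M : Mat2, IsUnit M.det ∧ P = pslash d M P₀}

/-- `B` is a `Γ₁`-equivalence class in `F_d`, where `Γ₁ = PSL₂(ℤ)`. -/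
def IsClassF1 (d : ℕ) (B : Set (Polynomial ℤ)) : Prop :=
  ∃ P₀ ∈ Fd d, B = {P ∈ Fd d | ∃ M : Mat2, M.det = 1 ∧ P = pslash d M P₀}

/-- `A^Sim = {P ∈ A : P(0) < 0 < P(∞)}`, where `P(∞)` is the coefficient of `X^d`. -/
def PSim (d : ℕ) (A : Set (Polynomial ℤ)) : Set (Polynomial ℤ) :=
  {P ∈ A | P.coeff 0 < 0 ∧ 0 < P.coeff d}

/-- `A^Red = {P ∈ A : P(∞) > 0 and P(-1) < 0 < P(0)}`. -/
def PRed (d : ℕ) (A : Set (Polynomial ℤ)) : Set (Polynomial ℤ) :=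
  {P ∈ A | 0 < P.coeff d ∧ Polynomial.aeval (-1 : ℤ) P < 0 ∧ 0 < P.coeff 0}

/-- `A⟨x⟩ = {P ∈ A : P(∞) < 0 < P(x)}`. -/
def Px (d : ℕ) (A : Set (Polynomial ℤ)) (x : ℝ) : Set (Polynomial ℤ) :=
  {P ∈ A | P.coeff d < 0 ∧ 0 < Polynomial.aeval x P}

/-- The numerators of the convergents, shifted by 2: `pconv x i = p_{i-2}`. -/
def pconv (x : ℝ) : ℕ → ℤ
  | 0 => 0
  | 1 => 1
  | i + 2 => cfN x i * pconv x (i + 1) + pconv x i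

/-- The denominators of the convergents, shifted by 2: `qconv x i = q_{i-2}`. -/
def qconv (x : ℝ) : ℕ → ℤ
  | 0 => 1
  | 1 => 0
  | i + 2 => cfN x i * qconv x (i + 1) + qconv x i

/-- `δ_i = (-1)^i (p_{i-1} - q_{i-1} x)` for `i ≥ 0`. -/
def cfDelta (x : ℝ) (i : ℕ) : ℝ :=
  (-1 : ℝ) ^ i * ((pconv x (i + 1) : ℝ) - (qconv x (i + 1) : ℝ) * x)

/-- The weight `d` action `(P|γ)(X) = (tX+u)^d P((rX+s)/(tX+u))` on complex polynomials
of degree at most `d`, for `γ = [[r,s],[t,u]]` with integer entries. -/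
def cslash (d : ℕ) (M : Mat2) (P : Polynomial ℂ) : Polynomial ℂ :=
  ∑ j ∈ Finset.range (d + 1),
    C (P.coeff j) * (C (M 0 0 : ℂ) * X + C (M 0 1 : ℂ)) ^ j *
      (C (M 1 0 : ℂ) * X + C (M 1 1 : ℂ)) ^ (d - j)

/-- `P^Γ(x) = ∑_{γ ∈ Γ(x)} (P|γ)(x)` for `P` of degree ≤ 2k. -/
def PGam (k : ℕ) (P : Polynomial ℂ) (x : ℝ) : ℂ :=
  ∑' γ : GammaSet x, Polynomial.eval (x : ℂ) (cslash (2 * k) γ.1 P)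

/-- The homogenization `∑ P_j a^j b^{d-j}` of `P` in degree `d`, evaluated at `(a, b)`. -/
def homogEval (d : ℕ) (P : Polynomial ℂ) (a b : ℂ) : ℂ :=
  ∑ j ∈ Finset.range (d + 1), P.coeff j * a ^ j * b ^ (d - j)

theorem eval_cslash (d : ℕ) (M : Mat2) (P : Polynomial ℂ) (x : ℂ) :
    (cslash d M P).eval x = homogEval d P (M 0 0 * x + M 0 1) (M 1 0 * x + M 1 1) := by
  simp [cslash, homogEval, eval_finsetSum]

theorem homogEval_one_right {d : ℕ} {P : Polynomial ℂ} (hP : P.natDegree ≤ d) (a : ℂ) :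
    homogEval d P a 1 = P.eval a := by
  simp [homogEval, eval_eq_sum_range' (Nat.lt_succ_of_le hP)]

theorem homogEval_neg_neg (k : ℕ) (P : Polynomial ℂ) (a b : ℂ) :
    homogEval (2 * k) P (-a) (-b) = homogEval (2 * k) P a b := by
  refine Finset.sum_congr rfl fun j hj => ?_
  have hj : j ≤ 2 * k := Nat.lt_succ_iff.mp (Finset.mem_range.mp hj)
  have h : (-1 : ℂ) ^ j * (-1) ^ (2 * k - j) = 1 := by
    rw [← pow_add, Nat.add_sub_cancel' hj, pow_mul, neg_one_sq, one_pow]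
  rw [neg_pow a, neg_pow b]
  linear_combination (P.coeff j * a ^ j * b ^ (2 * k - j)) * h

theorem norm_homogEval_le {d : ℕ} (P : Polynomial ℂ) {a b : ℝ} (hb : 0 ≤ b) (hba : b ≤ a) :
    ‖homogEval d P a b‖ ≤ (∑ j ∈ Finset.range (d + 1), ‖P.coeff j‖) * a ^ d := by
  rw [Finset.sum_mul]
  refine (norm_sum_le _ _).trans (Finset.sum_le_sum fun j hj => ?_)
  have hj : j ≤ d := Nat.lt_succ_iff.mp (Finset.mem_range.mp hj)
  have ha : 0 ≤ a := hb.trans hba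
  rw [norm_mul, norm_mul, norm_pow, norm_pow, Complex.norm_real, Complex.norm_real,
    Real.norm_of_nonneg ha, Real.norm_of_nonneg hb, mul_assoc]
  gcongr
  calc a ^ j * b ^ (d - j) ≤ a ^ j * a ^ (d - j) := by gcongr
    _ = a ^ d := by rw [← pow_add, Nat.add_sub_cancel' hj]

theorem natDegree_cslash_le (d : ℕ) (M : Mat2) (P : Polynomial ℂ) :
    (cslash d M P).natDegree ≤ d := by
  refine natDegree_sum_le_of_forall_le _ _ fun j hj => ?_
  have hj : j ≤ d := Nat.lt_succ_iff.mp (Finset.mem_range.mp hj)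
  have h (a b : ℂ) (n : ℕ) : ((C a * X + C b) ^ n).natDegree ≤ n := by
    simpa using natDegree_pow_le_of_le n (natDegree_linear_le (a := a) (b := b))
  have h0 := natDegree_mul_le_of_le
    (natDegree_mul_le_of_le (natDegree_C (P.coeff j)).le (h (M 0 0) (M 0 1) j))
    (h (M 1 0) (M 1 1) (d - j))
  exact h0.trans (by omega)

theorem irrational_cfX {x : ℝ} (hx : Irrational x) (i : ℕ) : Irrational (cfX x i) := by
  induction i with
  | zero => exact hx
  | succ i ih => simpa [cfX] using (ih.sub_intCast ⌊cfX x i⌋).inv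

/-- The product of the fractional parts of the first `i` complete quotients of `x`. -/
def fractProd (x : ℝ) (i : ℕ) : ℝ := ∏ l ∈ Finset.range i, Int.fract (cfX x l)

theorem fractProd_succ (x : ℝ) (i : ℕ) :
    fractProd x (i + 1) = fractProd x i * Int.fract (cfX x i) := Finset.prod_range_succ _ _

theorem cfX_succ (x : ℝ) (i : ℕ) : cfX x (i + 1) = (Int.fract (cfX x i))⁻¹ := by
  rw [cfX, one_div, Int.self_sub_floor]

theorem fract_pos_of_irrational {x : ℝ} (hx : Irrational x) : 0 < Int.fract x :=
  Int.fract_pos.mpr (hx.ne_int _)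

theorem fractProd_pos {x : ℝ} (hx : Irrational x) (i : ℕ) : 0 < fractProd x i :=
  Finset.prod_pos fun l _ => fract_pos_of_irrational (irrational_cfX hx l)

theorem fractProd_strictAnti {x : ℝ} (hx : Irrational x) : StrictAnti (fractProd x) :=
  strictAnti_nat_of_succ_lt fun i => by
    rw [fractProd_succ]
    exact mul_lt_of_lt_one_right (fractProd_pos hx i) (Int.fract_lt_one _)

theorem gam_rows {x : ℝ} (hx : Irrational x) (i : ℕ) :
    (gam x i 0 0 : ℝ) * x + gam x i 0 1 = cfX x i * fractProd x i ∧
      (gam x i 1 0 : ℝ) * x + gam x i 1 1 = fractProd x i := by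
  induction i with
  | zero => simp [gam, cfX, fractProd]
  | succ i ih =>
    have hf := (fract_pos_of_irrational (irrational_cfX hx i)).ne'
    have hn : (cfN x i : ℝ) = cfX x i - Int.fract (cfX x i) := by
      simp [cfN]
    rw [cfX_succ, fractProd_succ]
    obtain ⟨h0, h1⟩ := ih
    constructor
    · simp [gam, Meps, Tpow, Matrix.mul_apply, Fin.sum_univ_two]
      field_simp
      linear_combination h1
    · simp [gam, Meps, Tpow, Matrix.mul_apply, Fin.sum_univ_two]
      linear_combination h0 - cfN x i * h1 - fractProd x i * hn

theorem gam_succ_rows {x : ℝ} (hx : Irrational x) (i : ℕ) :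
    (gam x (i + 1) 0 0 : ℝ) * x + gam x (i + 1) 0 1 = fractProd x i ∧
      (gam x (i + 1) 1 0 : ℝ) * x + gam x (i + 1) 1 1 = fractProd x (i + 1) := by
  refine ⟨?_, (gam_rows hx (i + 1)).2⟩
  have hf := (fract_pos_of_irrational (irrational_cfX hx i)).ne'
  rw [(gam_rows hx (i + 1)).1, cfX_succ, fractProd_succ]
  field_simp

theorem gam_injective {x : ℝ} (hx : Irrational x) : Function.Injective (gam x) := by
  intro i j h
  apply (fractProd_strictAnti hx).injective
  rw [← (gam_rows hx i).2, ← (gam_rows hx j).2, h]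

theorem PGam_eq_tsum {x : ℝ} (hx : Irrational x) (k : ℕ) (P : Polynomial ℂ) :
    PGam k P x = ∑' i, homogEval (2 * k) P (fractProd x i) (fractProd x (i + 1)) := by
  have hinj : Function.Injective fun i => gam x (i + 1) :=
    (gam_injective hx).comp (add_left_injective 1)
  have hset : GammaSet x = Set.range fun i => gam x (i + 1) := by
    ext M
    constructor
    · rintro ⟨i, hi, rfl⟩
      exact ⟨i - 1, by simp [Nat.sub_add_cancel hi]⟩
    · rintro ⟨i, rfl⟩
      exact ⟨i + 1, by omega, rfl⟩
  rw [PGam, hset, tsum_range (fun M => eval (x : ℂ) (cslash (2 * k) M P)) hinj]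
  refine tsum_congr fun i => ?_
  obtain ⟨h0, h1⟩ := gam_succ_rows hx i
  rw [eval_cslash, ← h0, ← h1]
  push_cast
  rfl

theorem fractProd_succ_le_sub {x : ℝ} (hx : Irrational x) (i : ℕ) :
    fractProd x (i + 1) ≤ fractProd x i - fractProd x (i + 2) := by
  have hf := fract_pos_of_irrational (irrational_cfX hx i)
  have h1 : 1 ≤ ⌊cfX x (i + 1)⌋ := by
    rw [Int.le_floor, cfX_succ, Int.cast_one]
    exact (one_le_inv₀ hf).mpr (Int.fract_lt_one _).le
  have h2 : (1 : ℝ) ≤ cfX x (i + 1) - Int.fract (cfX x (i + 1)) := by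
    rw [Int.self_sub_fract]
    exact_mod_cast h1
  have h3 : fractProd x (i + 1) * cfX x (i + 1) = fractProd x i := by
    rw [cfX_succ, fractProd_succ]
    field_simp
  rw [fractProd_succ x (i + 1)]
  nlinarith [mul_le_mul_of_nonneg_left h2 (fractProd_pos hx (i + 1)).le]

theorem summable_fractProd {x : ℝ} (hx : Irrational x) : Summable (fractProd x) := by
  rw [← summable_nat_add_iff 1]
  refine summable_of_sum_range_le (c := fractProd x 0 + fractProd x 1)
    (fun n => (fractProd_pos hx _).le) fun n => ?_
  have key : ∑ i ∈ Finset.range n, fractProd x (i + 1) ≤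
      fractProd x 0 + fractProd x 1 - fractProd x n - fractProd x (n + 1) := by
    induction n with
    | zero => simp
    | succ n ih =>
      rw [Finset.sum_range_succ]
      linarith [fractProd_succ_le_sub hx n]
  linarith [fractProd_pos hx n, fractProd_pos hx (n + 1)]

theorem summable_homogEval_fractProd {x : ℝ} (hx : Irrational x) {d : ℕ} (hd : d ≠ 0)
    (P : Polynomial ℂ) :
    Summable fun i => homogEval d P (fractProd x i) (fractProd x (i + 1)) := by
  refine Summable.of_norm_bounded
    ((summable_fractProd hx).mul_left (∑ j ∈ Finset.range (d + 1), ‖P.coeff j‖)) fun i => ?_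
  refine (norm_homogEval_le P (fractProd_pos hx _).le
    (fractProd_strictAnti hx i.lt_succ_self).le).trans ?_
  have h1 : fractProd x i ≤ 1 := by
    simpa [fractProd] using (fractProd_strictAnti hx).antitone i.zero_le
  have h0 := (fractProd_pos hx i).le
  gcongr
  exact pow_le_of_le_one h0 h1 hd

theorem cfX_one (x : ℝ) : cfX x 1 = (Int.fract x)⁻¹ := cfX_succ x 0

theorem fract_neg_eq {x : ℝ} (hx : Irrational x) : Int.fract (-x) = 1 - Int.fract x :=
  Int.fract_neg (fract_pos_of_irrational hx).ne'

theorem fract_cfX_neg_one {x : ℝ} (hx : Irrational x) (h : Int.fract x < 1 / 2) :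
    Int.fract (cfX (-x) 1) = Int.fract x / (1 - Int.fract x) := by
  have h0 := fract_pos_of_irrational hx
  have h1 : 0 < 1 - Int.fract x := by linarith
  rw [cfX_one, fract_neg_eq hx, Int.fract_eq_iff]
  refine ⟨by positivity, by rw [div_lt_one h1]; linarith, 1, ?_⟩
  field_simp
  push_cast
  ring

theorem cfX_neg_two {x : ℝ} (hx : Irrational x) (h : Int.fract x < 1 / 2) :
    cfX (-x) 2 = cfX x 1 - 1 := by
  have h0 := fract_pos_of_irrational hx
  rw [cfX_succ, fract_cfX_neg_one hx h, cfX_one]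
  field_simp

theorem fract_cfX_neg_add_two {x : ℝ} (hx : Irrational x) (h : Int.fract x < 1 / 2) (i : ℕ) :
    Int.fract (cfX (-x) (i + 2)) = Int.fract (cfX x (i + 1)) := by
  induction i with
  | zero => rw [zero_add, cfX_neg_two hx h, Int.fract_sub_one]
  | succ i ih => rw [cfX_succ, cfX_succ x, ih]

theorem fractProd_neg_add_two {x : ℝ} (hx : Irrational x) (h : Int.fract x < 1 / 2) (i : ℕ) :
    fractProd (-x) (i + 2) = fractProd x (i + 1) := by
  induction i with
  | zero =>
    have h1 : 1 - Int.fract x ≠ 0 := by linarith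
    simp [fractProd, Finset.prod_range_succ, fract_cfX_neg_one hx h]
    rw [show cfX (-x) 0 = -x from rfl, show cfX x 0 = x from rfl, fract_neg_eq hx]
    field_simp
  | succ i ih => rw [fractProd_succ, fractProd_succ x, ih, fract_cfX_neg_add_two hx h]

theorem PGam_sub_PGam_neg {x : ℝ} (hx : Irrational x) (h : Int.fract x < 1 / 2)
    {k : ℕ} (hk : 1 ≤ k) (P : Polynomial ℂ) :
    PGam k P x - PGam k P (-x) =
      homogEval (2 * k) P 1 (Int.fract x : ℝ) - homogEval (2 * k) P 1 (1 - (Int.fract x : ℝ)) -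
        homogEval (2 * k) P (1 - (Int.fract x : ℝ)) (Int.fract x : ℝ) := by
  have hd : 2 * k ≠ 0 := by omega
  have hs := summable_homogEval_fractProd hx hd P
  have hs' := summable_homogEval_fractProd hx.neg hd P
  have e0 (z : ℝ) : fractProd z 0 = 1 := by simp [fractProd]
  have e1 (z : ℝ) : fractProd z 1 = Int.fract z := by simp [fractProd, cfX]
  rw [PGam_eq_tsum hx, PGam_eq_tsum hx.neg, hs.tsum_eq_zero_add, hs'.tsum_eq_zero_add,
    ((summable_nat_add_iff 1).mpr hs').tsum_eq_zero_add]
  simp only [add_assoc, Nat.reduceAdd, zero_add, e0, e1, fract_neg_eq hx,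
    fractProd_neg_add_two hx h]
  push_cast
  ring

/-- **Theorem 6(ii).** For `k ≥ 1`, `P ∈ ℂ[X]` of degree ≤ 2k and
`x` irrational with continued fraction `x = [n₀; n₁, …]`, where `P₁ = P|(1+ε)` and
`P₂ = P|(1+U-SU²)ε`:
`P^Γ(x) - P^Γ(-x) = (-P₁|T^{n₀+1}σ)(x) + (P₂|T^{-n₀})(x)` if `n₁ ≥ 2`, and
`P^Γ(x) - P^Γ(-x) = (P₁|T^{-n₀})(x) - (P₂|T^{n₀+1}σ)(x)` if `n₁ = 1`. -/
theorem stmt13 (k : ℕ) (hk : 1 ≤ k) (P : Polynomial ℂ) (hP : P.natDegree ≤ 2 * k)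
    (x : ℝ) (hx : Irrational x)
    (P1 P2 : Polynomial ℂ)
    (hP1 : P1 = P + cslash (2 * k) Meps P)
    (hP2 : P2 = cslash (2 * k) Meps P + cslash (2 * k) (MU * Meps) P
      - cslash (2 * k) (MS * MU * MU * Meps) P) :
    (2 ≤ cfN x 1 →
      PGam k P x - PGam k P (-x) =
        -Polynomial.eval (x : ℂ) (cslash (2 * k) (Tpow (cfN x 0 + 1) * Msig) P1) +
          Polynomial.eval (x : ℂ) (cslash (2 * k) (Tpow (-(cfN x 0))) P2)) ∧
    (cfN x 1 = 1 →
      PGam k P x - PGam k P (-x) =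
        Polynomial.eval (x : ℂ) (cslash (2 * k) (Tpow (-(cfN x 0))) P1) -
          Polynomial.eval (x : ℂ) (cslash (2 * k) (Tpow (cfN x 0 + 1) * Msig) P2)) := by
  have hP1d : P1.natDegree ≤ 2 * k :=
    hP1 ▸ natDegree_add_le_of_degree_le hP (natDegree_cslash_le _ _ _)
  have hP2d : P2.natDegree ≤ 2 * k := by
    rw [hP2]
    exact (natDegree_sub_le_of_le (natDegree_add_le_of_degree_le (natDegree_cslash_le _ _ _)
      (natDegree_cslash_le _ _ _)) (natDegree_cslash_le _ _ _)).trans (max_self _).le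
  have hP1e (z : ℂ) : P1.eval z = homogEval (2 * k) P z 1 + homogEval (2 * k) P 1 z := by
    rw [hP1, eval_add, eval_cslash, homogEval_one_right hP]
    simp [Meps]
  have hP2e (z : ℂ) : P2.eval z = homogEval (2 * k) P 1 z + homogEval (2 * k) P (1 - z) 1 -
      homogEval (2 * k) P (1 - z) z := by
    rw [hP2, eval_sub, eval_add, eval_cslash, eval_cslash, eval_cslash,
      ← homogEval_neg_neg k P (1 - z) z]
    simp [Meps, MU, MS, MT, Matrix.mul_apply, Fin.sum_univ_two, sub_eq_add_neg, add_comm]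
  have hfr : ((Int.fract x : ℝ) : ℂ) = x - cfN x 0 := by
    rw [Int.fract, Complex.ofReal_sub, Complex.ofReal_intCast]
    rfl
  have hT {Q : Polynomial ℂ} (hQ : Q.natDegree ≤ 2 * k) :
      (cslash (2 * k) (Tpow (-(cfN x 0))) Q).eval (x : ℂ) = Q.eval ((Int.fract x : ℝ) : ℂ) := by
    rw [eval_cslash, hfr, ← homogEval_one_right hQ]
    simp [Tpow, sub_eq_add_neg]
  have hTs {Q : Polynomial ℂ} (hQ : Q.natDegree ≤ 2 * k) :
      (cslash (2 * k) (Tpow (cfN x 0 + 1) * Msig) Q).eval (x : ℂ) =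
        Q.eval (1 - ((Int.fract x : ℝ) : ℂ)) := by
    rw [eval_cslash, hfr, ← homogEval_one_right hQ]
    simp [Tpow, Msig, Matrix.mul_apply, Fin.sum_univ_two]
    ring_nf
  rw [hT hP1d, hT hP2d, hTs hP1d, hTs hP2d]
  simp only [hP1e, hP2e, cfN, cfX_one]
  have h0 := fract_pos_of_irrational hx
  constructor
  · intro hn
    have hlt : Int.fract x < 1 / 2 := by
      have h2 : (2 : ℝ) ≤ (Int.fract x)⁻¹ := by exact_mod_cast Int.le_floor.mp hn
      refine lt_of_le_of_ne (by rw [one_div]; exact (le_inv_comm₀ two_pos h0).mp h2) fun he => ?_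
      have hirr : Irrational (Int.fract x) := hx.sub_intCast ⌊x⌋
      exact hirr ⟨1 / 2, by rw [he]; norm_num⟩
    rw [PGam_sub_PGam_neg hx hlt hk]
    ring
  · intro hn
    have hlt : Int.fract (-x) < 1 / 2 := by
      have h2 : (Int.fract x)⁻¹ < 2 := by
        have := Int.lt_floor_add_one (Int.fract x)⁻¹
        rw [hn] at this
        norm_num at this
        exact this
      have := (inv_lt_comm₀ h0 two_pos).mp h2
      rw [fract_neg_eq hx]
      linarith
    have key := PGam_sub_PGam_neg hx.neg hlt hk P
    rw [neg_neg, fract_neg_eq hx] at key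
    push_cast at key
    rw [sub_sub_cancel] at key
    rw [sub_sub_cancel]
    linear_combination -key
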